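/- arXiv:1310.2273 — 5 statements merged into one kernel-verified Lean document; each statement's English description precedes it below -/
import Mathlib

section
/- In the near-separable setting with m = r, assume r ≥ 2 and ε ≤ σ_min(W)/(8 r √r). Then any optimal solution A* of the minimum-volume-ellipsoid SDP associated with M̃ satisfies λ_max(Wᵀ A* W) ≤ 40 · λ_min(Wᵀ A* W), i.e., the condition number of C* = Wᵀ A* W is at most 40. -/
open Matrix BigOperators

/-- Euclidean norm of a vector in `ℝ^m`. -/
noncomputable def colNorm {m : ℕ} (v : Fin m → ℝ) : ℝ := Real.sqrt (∑ i, (v i) ^ 2)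

/-- Largest singular value of a matrix. -/
noncomputable def sigmaMax {m n : ℕ} (X : Matrix (Fin m) (Fin n) ℝ) : ℝ :=
  sSup {c : ℝ | ∃ v : Fin n → ℝ, colNorm v = 1 ∧ c = colNorm (X.mulVec v)}

/-- Smallest singular value of a matrix. -/
noncomputable def sigmaMin {m n : ℕ} (X : Matrix (Fin m) (Fin n) ℝ) : ℝ :=
  sInf {c : ℝ | ∃ v : Fin n → ℝ, colNorm v = 1 ∧ c = colNorm (X.mulVec v)}

/-- Condition number `κ(X) = σ_max(X) / σ_min(X)`. -/
noncomputable def kappa {m n : ℕ} (X : Matrix (Fin m) (Fin n) ℝ) : ℝ :=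
  sigmaMax X / sigmaMin X

/-- Largest eigenvalue of a symmetric matrix, via the Rayleigh quotient. -/
noncomputable def lamMax {r : ℕ} (C : Matrix (Fin r) (Fin r) ℝ) : ℝ :=
  sSup {c : ℝ | ∃ v : Fin r → ℝ, colNorm v = 1 ∧ c = v ⬝ᵥ C.mulVec v}

/-- Smallest eigenvalue of a symmetric matrix, via the Rayleigh quotient. -/
noncomputable def lamMin {r : ℕ} (C : Matrix (Fin r) (Fin r) ℝ) : ℝ :=
  sInf {c : ℝ | ∃ v : Fin r → ℝ, colNorm v = 1 ∧ c = v ⬝ᵥ C.mulVec v}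

/-- Near-separable assumption with `m = r`: `Mt = W * H + N` where `W ∈ ℝ^{r×r}` is
invertible, `H = [I_r, H']` is nonnegative with column sums at most one and whose first `r`
columns form the identity matrix, and each column of `N` has Euclidean norm at most `ε`. -/
def NearSepSquare (r n : ℕ) (W : Matrix (Fin r) (Fin r) ℝ) (H : Matrix (Fin r) (Fin n) ℝ)
    (N Mt : Matrix (Fin r) (Fin n) ℝ) (ε : ℝ) : Prop :=
  IsUnit W.det ∧ Mt = W * H + N ∧ (∀ i j, 0 ≤ H i j) ∧ (∀ j, ∑ i, H i j ≤ 1) ∧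
    (∃ h : r ≤ n, ∀ i j : Fin r, H i (Fin.castLE h j) = if i = j then 1 else 0) ∧
    0 ≤ ε ∧ ∀ j, colNorm (fun i => N i j) ≤ ε

/-- `A` is feasible for the minimum-volume-ellipsoid SDP associated with `Mt`:
`A` is positive semidefinite and `m̃ᵢᵀ A m̃ᵢ ≤ 1` for every column `m̃ᵢ` of `Mt`. -/
def SDPFeasible {r n : ℕ} (Mt : Matrix (Fin r) (Fin n) ℝ)
    (A : Matrix (Fin r) (Fin r) ℝ) : Prop :=
  A.PosSemidef ∧ ∀ j : Fin n, (fun i => Mt i j) ⬝ᵥ A.mulVec (fun i => Mt i j) ≤ 1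

/-- `A` is an optimal solution of the minimum-volume-ellipsoid SDP associated with `Mt`:
it is feasible and maximizes the determinant among the feasible matrices. -/
def SDPOptimal {r n : ℕ} (Mt : Matrix (Fin r) (Fin n) ℝ)
    (A : Matrix (Fin r) (Fin r) ℝ) : Prop :=
  SDPFeasible Mt A ∧ ∀ B : Matrix (Fin r) (Fin r) ℝ, SDPFeasible Mt B → B.det ≤ A.det

lemma colNorm_eq_norm {m : ℕ} (v : Fin m → ℝ) : colNorm v = ‖WithLp.toLp 2 v‖ := by
  simp [colNorm, EuclideanSpace.norm_eq]

lemma colNorm_nonneg {m : ℕ} (v : Fin m → ℝ) : 0 ≤ colNorm v := Real.sqrt_nonneg _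

lemma colNorm_sq {m : ℕ} (v : Fin m → ℝ) : colNorm v ^ 2 = v ⬝ᵥ v := by
  rw [colNorm, Real.sq_sqrt (Finset.sum_nonneg fun i _ => sq_nonneg _)]
  simp [dotProduct, sq]

lemma colNorm_add_le {m : ℕ} (v w : Fin m → ℝ) : colNorm (v + w) ≤ colNorm v + colNorm w := by
  simp only [colNorm_eq_norm, WithLp.toLp_add]
  exact norm_add_le _ _

lemma colNorm_smul {m : ℕ} (c : ℝ) (v : Fin m → ℝ) : colNorm (c • v) = |c| * colNorm v := by
  simp only [colNorm_eq_norm, WithLp.toLp_smul, norm_smul, Real.norm_eq_abs]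

lemma exists_colNorm_eq_one {m : ℕ} (hm : 0 < m) : ∃ v : Fin m → ℝ, colNorm v = 1 := by
  refine ⟨Pi.single ⟨0, hm⟩ 1, ?_⟩
  simp [colNorm_eq_norm]

/-- A nonnegative vector with coordinate sum at most one has Euclidean norm at most one. -/
lemma colNorm_le_one {m : ℕ} (v : Fin m → ℝ) (h0 : ∀ i, 0 ≤ v i) (h1 : ∑ i, v i ≤ 1) :
    colNorm v ≤ 1 := by
  rw [colNorm, Real.sqrt_le_iff, one_pow]
  refine ⟨zero_le_one, ?_⟩
  refine le_trans (Finset.sum_le_sum fun i _ => ?_) h1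
  have : v i ≤ 1 := le_trans (Finset.single_le_sum (fun j _ => h0 j) (Finset.mem_univ i)) h1
  nlinarith [h0 i]

lemma sigmaMin_mul_colNorm_le {m n : ℕ} (X : Matrix (Fin m) (Fin n) ℝ) (v : Fin n → ℝ) :
    sigmaMin X * colNorm v ≤ colNorm (X *ᵥ v) := by
  rcases (colNorm_nonneg v).eq_or_lt with h | h
  · rw [← h, mul_zero]
    exact colNorm_nonneg _
  · have hle : sigmaMin X ≤ colNorm (X *ᵥ ((colNorm v)⁻¹ • v)) := by
      refine csInf_le ⟨0, ?_⟩ ⟨_, ?_, rfl⟩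
      · rintro c ⟨w, -, rfl⟩
        exact colNorm_nonneg _
      · rw [colNorm_smul, abs_of_pos (inv_pos.2 h), inv_mul_cancel₀ h.ne']
    rw [mulVec_smul, colNorm_smul, abs_of_pos (inv_pos.2 h)] at hle
    calc sigmaMin X * colNorm v ≤ ((colNorm v)⁻¹ * colNorm (X *ᵥ v)) * colNorm v := by gcongr
      _ = colNorm (X *ᵥ v) := by field_simp

lemma sigmaMin_pos {r : ℕ} (hr : 0 < r) (W : Matrix (Fin r) (Fin r) ℝ) (hW : IsUnit W.det) :
    0 < sigmaMin W := by
  set L := Matrix.toEuclideanCLM (𝕜 := ℝ) W⁻¹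
  have hL : ∀ v : Fin r → ℝ, colNorm v = 1 → 1 ≤ ‖L‖ * colNorm (W *ᵥ v) := by
    intro v hv
    have h := L.le_opNorm (WithLp.toLp 2 (W *ᵥ v))
    rwa [Matrix.toEuclideanCLM_toLp, mulVec_mulVec, nonsing_inv_mul _ hW, one_mulVec,
      ← colNorm_eq_norm, ← colNorm_eq_norm, hv] at h
  obtain ⟨w, hw⟩ := exists_colNorm_eq_one hr
  have hpos : 0 < ‖L‖ := by
    refine (norm_nonneg L).lt_of_ne fun h => ?_
    have := hL w hw
    rw [← h, zero_mul] at this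
    linarith
  refine lt_of_lt_of_le (inv_pos.2 hpos) (le_csInf ⟨_, w, hw, rfl⟩ ?_)
  rintro c ⟨v, hv, rfl⟩
  rw [inv_le_iff_one_le_mul₀' hpos]
  exact hL v hv

section Rayleigh

variable {r : ℕ} {C : Matrix (Fin r) (Fin r) ℝ}

/-- The quadratic form of a symmetric matrix in an orthonormal eigenbasis. -/
lemma exists_coords_quadratic_form (hC : C.IsHermitian) (v : Fin r → ℝ) :
    ∃ w : Fin r → ℝ, ∑ k, w k ^ 2 = v ⬝ᵥ v ∧
      v ⬝ᵥ C *ᵥ v = ∑ k, hC.eigenvalues k * w k ^ 2 := by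
  set U := (hC.eigenvectorUnitary : Matrix (Fin r) (Fin r) ℝ)
  have hUU : U * Uᵀ = 1 := by
    have := Unitary.coe_mul_star_self hC.eigenvectorUnitary
    rwa [Unitary.coe_star, star_eq_conjTranspose, conjTranspose_eq_transpose_of_trivial] at this
  have hspec : C = U * diagonal hC.eigenvalues * Uᵀ := by
    have := hC.spectral_theorem
    rw [Unitary.conjStarAlgAut_apply, star_eq_conjTranspose,
      conjTranspose_eq_transpose_of_trivial] at this
    exact this
  have hquad : ∀ D : Matrix (Fin r) (Fin r) ℝ,
      v ⬝ᵥ (U * D * Uᵀ) *ᵥ v = (Uᵀ *ᵥ v) ⬝ᵥ D *ᵥ (Uᵀ *ᵥ v) := by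
    intro D
    rw [← mulVec_mulVec, ← mulVec_mulVec, dotProduct_mulVec, mulVec_transpose]
  refine ⟨Uᵀ *ᵥ v, ?_, ?_⟩
  · have := hquad 1
    rw [mul_one, hUU, one_mulVec, one_mulVec] at this
    rw [this]
    simp [dotProduct, sq]
  · conv_lhs => rw [hspec, hquad]
    simp only [dotProduct, mulVec_diagonal]
    exact Finset.sum_congr rfl fun k _ => by ring

lemma quadratic_form_le (hC : C.IsHermitian) {a : ℝ} (ha : ∀ k, hC.eigenvalues k ≤ a)
    (v : Fin r → ℝ) : v ⬝ᵥ C *ᵥ v ≤ a * (v ⬝ᵥ v) := by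
  obtain ⟨w, hw, hv⟩ := exists_coords_quadratic_form hC v
  rw [hv, ← hw, Finset.mul_sum]
  exact Finset.sum_le_sum fun k _ => mul_le_mul_of_nonneg_right (ha k) (sq_nonneg _)

lemma le_quadratic_form (hC : C.IsHermitian) {b : ℝ} (hb : ∀ k, b ≤ hC.eigenvalues k)
    (v : Fin r → ℝ) : b * (v ⬝ᵥ v) ≤ v ⬝ᵥ C *ᵥ v := by
  obtain ⟨w, hw, hv⟩ := exists_coords_quadratic_form hC v
  rw [hv, ← hw, Finset.mul_sum]
  exact Finset.sum_le_sum fun k _ => mul_le_mul_of_nonneg_right (hb k) (sq_nonneg _)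

lemma lamMax_le (hr : 0 < r) (hC : C.IsHermitian) {a : ℝ} (ha : ∀ k, hC.eigenvalues k ≤ a) :
    lamMax C ≤ a := by
  obtain ⟨w, hw⟩ := exists_colNorm_eq_one hr
  refine csSup_le ⟨_, w, hw, rfl⟩ ?_
  rintro c ⟨v, hv, rfl⟩
  have := quadratic_form_le hC ha v
  rwa [← colNorm_sq, hv, one_pow, mul_one] at this

lemma le_lamMin (hr : 0 < r) (hC : C.IsHermitian) {b : ℝ} (hb : ∀ k, b ≤ hC.eigenvalues k) :
    b ≤ lamMin C := by
  obtain ⟨w, hw⟩ := exists_colNorm_eq_one hr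
  refine le_csInf ⟨_, w, hw, rfl⟩ ?_
  rintro c ⟨v, hv, rfl⟩
  have := le_quadratic_form hC hb v
  rwa [← colNorm_sq, hv, one_pow, mul_one] at this

lemma quadratic_form_le_trace (hC : C.PosSemidef) (v : Fin r → ℝ) :
    v ⬝ᵥ C *ᵥ v ≤ C.trace * (v ⬝ᵥ v) := by
  refine quadratic_form_le hC.isHermitian (fun k => ?_) v
  have htr : C.trace = ∑ i, hC.isHermitian.eigenvalues i := by
    simpa using hC.isHermitian.trace_eq_sum_eigenvalues
  rw [htr]
  exact Finset.single_le_sum (fun i _ => hC.eigenvalues_nonneg i) (Finset.mem_univ k)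

/-- Weighted Young inequality for the seminorm of a positive semidefinite matrix. -/
lemma quadratic_form_young (hC : C.PosSemidef) {t : ℝ} (ht : 0 < t) (e u : Fin r → ℝ) :
    e ⬝ᵥ C *ᵥ e ≤ (1 + t) * ((e + u) ⬝ᵥ C *ᵥ (e + u)) + (1 + 1 / t) * (u ⬝ᵥ C *ᵥ u) := by
  have h := hC.dotProduct_mulVec_nonneg (t • (e + u) + u)
  have hsymm : (e + u) ⬝ᵥ C *ᵥ u = u ⬝ᵥ C *ᵥ (e + u) := by
    have hT : Cᵀ = C := by
      have := hC.isHermitian.eq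
      rwa [conjTranspose_eq_transpose_of_trivial] at this
    rw [dotProduct_mulVec, ← mulVec_transpose, hT, dotProduct_comm]
  have he : e ⬝ᵥ C *ᵥ e = (e + u) ⬝ᵥ C *ᵥ (e + u) - 2 * (u ⬝ᵥ C *ᵥ (e + u)) + u ⬝ᵥ C *ᵥ u := by
    have h1 : e = (e + u) - u := by simp
    conv_lhs => rw [h1]
    rw [mulVec_sub, sub_dotProduct, dotProduct_sub, dotProduct_sub, hsymm]
    ring
  simp only [star_trivial, mulVec_add, mulVec_smul, add_dotProduct, smul_dotProduct,
    dotProduct_add, dotProduct_smul, smul_eq_mul] at h he hsymm ⊢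
  generalize e ⬝ᵥ C *ᵥ e = x at *
  generalize e ⬝ᵥ C *ᵥ u = y at *
  generalize u ⬝ᵥ C *ᵥ e = y' at *
  generalize u ⬝ᵥ C *ᵥ u = z at *
  have hy : y = y' := by linarith
  subst hy
  have key : (1 + t) * (x + y + (y + z)) + (1 + 1 / t) * z - x =
      (t * (t * (x + y) + t * (y + z)) + t * (y + z) + (t * (y + z) + z)) / t := by
    field_simp
    ring
  have : 0 ≤ (t * (t * (x + y) + t * (y + z)) + t * (y + z) + (t * (y + z) + z)) / t :=
    div_nonneg (by linarith) ht.le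
  linarith

/-- If the ellipsoid of `C` contains a small perturbation of the standard basis,
then the trace of `C` is at most `r + 1`. -/
lemma trace_le_of_perturbed_basis (hr : 2 ≤ r) (hC : C.PosSemidef) {δ : ℝ}
    (hδ : 64 * (r : ℝ) ^ 3 * δ ^ 2 ≤ 1) (u : Fin r → Fin r → ℝ) (hu : ∀ i, u i ⬝ᵥ u i ≤ δ ^ 2)
    (hfeas : ∀ i, (Pi.single i 1 + u i) ⬝ᵥ C *ᵥ (Pi.single i 1 + u i) ≤ 1) :
    C.trace ≤ r + 1 := by
  have hr' : (2 : ℝ) ≤ r := by exact_mod_cast hr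
  have hT : 0 ≤ C.trace := hC.trace_nonneg
  have hdiag : ∀ i, C i i ≤ (1 + 1 / (2 * r)) + (1 + 2 * r) * (C.trace * δ ^ 2) := by
    intro i
    have h := quadratic_form_young hC (t := 1 / (2 * r)) (by positivity) (Pi.single i 1) (u i)
    have hii : (Pi.single i 1 : Fin r → ℝ) ⬝ᵥ C *ᵥ (Pi.single i 1) = C i i := by simp
    rw [hii, one_div_one_div] at h
    have h2 : u i ⬝ᵥ C *ᵥ u i ≤ C.trace * δ ^ 2 :=
      (quadratic_form_le_trace hC _).trans (mul_le_mul_of_nonneg_left (hu i) hT)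
    calc C i i ≤ _ := h
      _ ≤ (1 + 1 / (2 * r)) * 1 + (1 + 2 * r) * (C.trace * δ ^ 2) := by
        gcongr
        exact hfeas i
      _ = _ := by ring
  have hsum : C.trace ≤ r * ((1 + 1 / (2 * r)) + (1 + 2 * r) * (C.trace * δ ^ 2)) := by
    calc C.trace = ∑ i, C i i := rfl
      _ ≤ ∑ _i : Fin r, ((1 + 1 / (2 * r)) + (1 + 2 * r) * (C.trace * δ ^ 2)) :=
        Finset.sum_le_sum fun i _ => hdiag i
      _ = _ := by
        rw [Finset.sum_const, Finset.card_univ, Fintype.card_fin, nsmul_eq_mul]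
  have hsum' : C.trace ≤ r + 1 / 2 + C.trace * (r * (1 + 2 * r) * δ ^ 2) := by
    calc C.trace ≤ _ := hsum
      _ = _ := by
        have : (r : ℝ) * (1 / (2 * r)) = 1 / 2 := by field_simp
        linear_combination this
  have hsmall : r * (1 + 2 * r) * δ ^ 2 * (r + 1) ≤ 1 / 2 := by
    have : r * (1 + 2 * r) * (r + 1) ≤ 32 * (r : ℝ) ^ 3 := by nlinarith [sq_nonneg (r : ℝ)]
    nlinarith [sq_nonneg δ]
  have hq : 0 ≤ r * (1 + 2 * r) * δ ^ 2 := by positivity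
  generalize r * (1 + 2 * r) * δ ^ 2 = q at *
  by_contra! hcon
  have hq1 : q < 1 := by nlinarith
  nlinarith

/-- A trace upper bound and a determinant lower bound control the condition number. -/
lemma lamMax_le_forty_mul_lamMin (hr : 0 < r) (hC : C.PosSemidef) (htr : C.trace ≤ r + 1)
    (hdet : Real.exp (-1) ≤ C.det) : lamMax C ≤ 40 * lamMin C := by
  have hH := hC.isHermitian
  set l := hH.eigenvalues
  have hl0 : ∀ k, 0 ≤ l k := hC.eigenvalues_nonneg
  have hne : (Finset.univ : Finset (Fin r)).Nonempty := ⟨⟨0, hr⟩, Finset.mem_univ _⟩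
  obtain ⟨i, -, hi⟩ := Finset.exists_max_image Finset.univ l hne
  obtain ⟨j, -, hj⟩ := Finset.exists_min_image Finset.univ l hne
  have hmax : lamMax C ≤ l i := lamMax_le hr hH fun k => hi k (Finset.mem_univ k)
  have hmin : l j ≤ lamMin C := le_lamMin hr hH fun k => hj k (Finset.mem_univ k)
  suffices h : l i ≤ 40 * l j by linarith
  by_contra! hcon
  have hij : j ≠ i := by
    rintro rfl
    linarith [hl0 j]
  have hdetl : C.det = ∏ k, l k := by simpa using hH.det_eq_prod_eigenvalues
  have htrl : C.trace = ∑ k, l k := by simpa using hH.trace_eq_sum_eigenvalues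
  have hjmem : j ∈ Finset.univ.erase i := by simp [hij]
  set S := (Finset.univ.erase i).erase j
  have hprod : C.det = l i * (l j * ∏ k ∈ S, l k) := by
    rw [hdetl, Finset.mul_prod_erase _ _ hjmem, Finset.mul_prod_erase _ _ (Finset.mem_univ i)]
  have hsum : ∑ k, (l k - 1) = (l i - 1) + ((l j - 1) + ∑ k ∈ S, (l k - 1)) := by
    rw [Finset.add_sum_erase _ (fun k => l k - 1) hjmem,
      Finset.add_sum_erase _ (fun k => l k - 1) (Finset.mem_univ i)]
  have htot : ∑ k, (l k - 1) ≤ 1 := by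
    rw [Finset.sum_sub_distrib, ← htrl]
    simp
    linarith
  have hrest : ∏ k ∈ S, l k ≤ Real.exp (3 - l i) := by
    calc ∏ k ∈ S, l k ≤ ∏ k ∈ S, Real.exp (l k - 1) :=
          Finset.prod_le_prod (fun k _ => hl0 k)
            fun k _ => by linarith [Real.add_one_le_exp (l k - 1)]
      _ = Real.exp (∑ k ∈ S, (l k - 1)) := (Real.exp_sum _ _).symm
      _ ≤ Real.exp (3 - l i) := Real.exp_le_exp.2 (by linarith [hl0 j])
  have hrest0 : 0 ≤ ∏ k ∈ S, l k := Finset.prod_nonneg fun k _ => hl0 k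
  have hhalf : l i / 2 ≤ Real.exp (l i / 2 - 1) := by
    linarith [Real.add_one_le_exp (l i / 2 - 1)]
  have hsq : l i ^ 2 ≤ 4 * Real.exp (l i - 2) := by
    have : (l i / 2) ^ 2 ≤ Real.exp (l i / 2 - 1) ^ 2 :=
      pow_le_pow_left₀ (by linarith [hl0 i]) hhalf 2
    rw [← Real.exp_nat_mul] at this
    ring_nf at this ⊢
    linarith
  have hbound : 40 * C.det ≤ 4 * Real.exp 1 := by
    calc 40 * C.det = l i * (40 * l j) * ∏ k ∈ S, l k := by rw [hprod]; ring
      _ ≤ l i * l i * Real.exp (3 - l i) := by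
        gcongr
        · exact mul_nonneg (hl0 i) (by linarith [hl0 j])
        · exact hl0 i
      _ = l i ^ 2 * Real.exp (3 - l i) := by ring
      _ ≤ 4 * Real.exp (l i - 2) * Real.exp (3 - l i) := by gcongr
      _ = 4 * Real.exp 1 := by
        rw [mul_assoc, ← Real.exp_add]
        ring_nf
  have hone : Real.exp (-1) * Real.exp 1 = 1 := by rw [← Real.exp_add]; simp
  nlinarith [Real.exp_one_lt_three, Real.exp_pos 1]

end Rayleigh

/-- If `r ≥ 2` and `ε ≤ σ_min(W)/(8 r √r)`, then any optimal solution `A*` of the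
minimum-volume-ellipsoid SDP satisfies `κ(Wᵀ A* W) ≤ 40`, i.e.,
`λ_max(Wᵀ A* W) ≤ 40 λ_min(Wᵀ A* W)`. -/
theorem condition_number_bound (r n : ℕ) (W : Matrix (Fin r) (Fin r) ℝ)
    (H : Matrix (Fin r) (Fin n) ℝ) (N Mt : Matrix (Fin r) (Fin n) ℝ) (ε : ℝ)
    (A : Matrix (Fin r) (Fin r) ℝ)
    (hr : 2 ≤ r) (hsep : NearSepSquare r n W H N Mt ε)
    (hε : ε ≤ sigmaMin W / (8 * r * Real.sqrt r)) (hA : SDPOptimal Mt A) :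
    lamMax (Wᵀ * A * W) ≤ 40 * lamMin (Wᵀ * A * W) := by
  obtain ⟨hW, hMt, hH0, hH1, ⟨hrn, hHI⟩, hε0, hN⟩ := hsep
  obtain ⟨⟨hApsd, hAfeas⟩, hAopt⟩ := hA
  have hr0 : 0 < r := by omega
  have hr1 : (1 : ℝ) ≤ r := by exact_mod_cast hr0
  have hσ := sigmaMin_pos hr0 W hW
  set σ := sigmaMin W
  set δ := ε / σ with hδdef
  have hδ0 : 0 ≤ δ := div_nonneg hε0 hσ.le
  have hsqrt : 1 ≤ Real.sqrt r := Real.one_le_sqrt.2 hr1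
  have hsqrt2 : Real.sqrt r ^ 2 = r := Real.sq_sqrt (by linarith)
  have hδ : 8 * r * Real.sqrt r * δ ≤ 1 := by
    rw [le_div_iff₀ (by positivity)] at hε
    rw [hδdef, ← mul_div_assoc, div_le_one hσ]
    linarith
  have hδ1 : 2 * r * δ ≤ 1 := by
    have : 0 ≤ r * δ := by positivity
    nlinarith
  have hδ2 : 64 * (r : ℝ) ^ 3 * δ ^ 2 ≤ 1 := by
    have h := pow_le_one₀ (n := 2) (by positivity) hδ
    have : (8 * r * Real.sqrt r * δ) ^ 2 = 64 * (r : ℝ) ^ 3 * δ ^ 2 := by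
      rw [mul_pow, mul_pow, hsqrt2]
      ring
    linarith
  let u : Fin n → Fin r → ℝ := fun j => W⁻¹ *ᵥ (fun i => N i j)
  let p : Fin n → Fin r → ℝ := fun j => (fun i => H i j) + u j
  have hWp : ∀ j, W *ᵥ p j = fun i => Mt i j := by
    intro j
    simp only [p, u, mulVec_add, mulVec_mulVec, mul_nonsing_inv _ hW, one_mulVec, hMt]
    rfl
  have hu : ∀ j, colNorm (u j) ≤ δ := by
    intro j
    have h := sigmaMin_mul_colNorm_le W (u j)
    simp only [u, mulVec_mulVec, mul_nonsing_inv _ hW, one_mulVec] at h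
    rw [hδdef, le_div_iff₀ hσ, mul_comm]
    exact h.trans (hN j)
  have hp : ∀ j, colNorm (p j) ≤ 1 + δ := fun j =>
    (colNorm_add_le _ _).trans
      (add_le_add (colNorm_le_one _ (fun i => hH0 i j) (hH1 j)) (hu j))
  have hconj : ∀ (B : Matrix (Fin r) (Fin r) ℝ) (j : Fin n),
      (fun i => Mt i j) ⬝ᵥ B *ᵥ (fun i => Mt i j) = p j ⬝ᵥ (Wᵀ * B * W) *ᵥ p j := by
    intro B j
    rw [← hWp j, ← mulVec_mulVec, ← mulVec_mulVec, dotProduct_mulVec (p j), vecMul_transpose]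
  have hCpsd : (Wᵀ * A * W).PosSemidef := by
    have := hApsd.conjTranspose_mul_mul_same W
    rwa [conjTranspose_eq_transpose_of_trivial] at this
  refine lamMax_le_forty_mul_lamMin hr0 hCpsd ?_ ?_
  · refine trace_le_of_perturbed_basis hr hCpsd hδ2 (fun i => u (Fin.castLE hrn i)) ?_ ?_
    · intro i
      rw [← colNorm_sq]
      exact pow_le_pow_left₀ (colNorm_nonneg _) (hu _) 2
    · intro i
      have hpi : p (Fin.castLE hrn i) = Pi.single i 1 + u (Fin.castLE hrn i) := by
        ext k
        simp [p, hHI, Pi.single_apply]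
      rw [← hpi, ← hconj]
      exact hAfeas _
  · set c : ℝ := ((1 + δ) ^ 2)⁻¹ with hc
    have hc0 : 0 < c := by positivity
    set B : Matrix (Fin r) (Fin r) ℝ := c • ((W⁻¹)ᵀ * W⁻¹) with hB
    have hWB : Wᵀ * B * W = c • (1 : Matrix (Fin r) (Fin r) ℝ) := by
      have h1 : Wᵀ * (W⁻¹)ᵀ = 1 := by
        rw [← transpose_mul, nonsing_inv_mul _ hW, transpose_one]
      rw [hB, Matrix.mul_smul, Matrix.smul_mul, ← Matrix.mul_assoc, h1, Matrix.one_mul, nonsing_inv_mul _ hW]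
    have hBfeas : SDPFeasible Mt B := by
      refine ⟨?_, fun j => ?_⟩
      · have := (posSemidef_conjTranspose_mul_self W⁻¹).smul hc0.le
        rwa [conjTranspose_eq_transpose_of_trivial] at this
      · rw [hconj, hWB, smul_mulVec, one_mulVec, dotProduct_smul, ← colNorm_sq, smul_eq_mul, hc,
          inv_mul_le_one₀ (by positivity)]
        exact pow_le_pow_left₀ (colNorm_nonneg _) (hp j) 2
    have hdet : c ^ r ≤ (Wᵀ * A * W).det := by
      have h : (Wᵀ * B * W).det ≤ (Wᵀ * A * W).det := by
        simp only [det_mul, det_transpose]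
        nlinarith [hAopt B hBfeas, mul_self_nonneg W.det]
      rw [hWB, det_smul, det_one, mul_one, Fintype.card_fin] at h
      exact h
    refine le_trans ?_ hdet
    rw [Real.exp_neg, hc, inv_pow]
    refine inv_anti₀ (by positivity) ?_
    calc ((1 + δ) ^ 2) ^ r = (1 + δ) ^ (2 * r) := (pow_mul _ _ _).symm
      _ ≤ Real.exp δ ^ (2 * r) :=
        pow_le_pow_left₀ (by linarith) (by linarith [Real.add_one_le_exp δ]) _
      _ = Real.exp (2 * r * δ) := by
        rw [← Real.exp_nat_mul]
        push_cast
        rfl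
      _ ≤ Real.exp 1 := Real.exp_le_exp.2 hδ1
end

section
/- In the near-separable setting with m = r, assume r ≥ 2 and ε ≤ σ_min(W)/(8 r √r). Then any optimal solution A* of the minimum-volume-ellipsoid SDP associated with M̃ satisfies λ_min(Wᵀ A* W) ≥ 1/4. -/
open Matrix BigOperators

lemma colNorm_sum_le {m : ℕ} {ι : Type*} (s : Finset ι) (f : ι → Fin m → ℝ) :
    colNorm (∑ i ∈ s, f i) ≤ ∑ i ∈ s, colNorm (f i) := by
  simpa only [colNorm_eq_norm, WithLp.toLp_sum] using norm_sum_le s _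

lemma colNorm_eq_zero {m : ℕ} {v : Fin m → ℝ} (h : colNorm v = 0) : v = 0 := by
  rw [colNorm_eq_norm] at h
  simpa using h

lemma colNorm_mulVec_le {m n : ℕ} (D : Matrix (Fin m) (Fin n) ℝ) {t : ℝ}
    (ht : ∀ j, colNorm (fun i => D i j) ≤ t) (w : Fin n → ℝ) :
    colNorm (D *ᵥ w) ≤ t * Real.sqrt n * colNorm w := by
  rcases n.eq_zero_or_pos with rfl | hn
  · simp [colNorm, mulVec, dotProduct]
  have ht0 : 0 ≤ t := (colNorm_nonneg _).trans (ht ⟨0, hn⟩)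
  have hD : D *ᵥ w = ∑ j, w j • fun i => D i j := by
    ext i
    simp [mulVec, dotProduct, mul_comm]
  have habs : ∑ j, |w j| ≤ Real.sqrt n * colNorm w := by
    rw [colNorm, ← Real.sqrt_mul (Nat.cast_nonneg n)]
    refine Real.le_sqrt_of_sq_le ?_
    simpa using sq_sum_le_card_mul_sum_sq (s := Finset.univ) (f := fun j => |w j|)
  calc colNorm (D *ᵥ w) ≤ ∑ j, colNorm (w j • fun i => D i j) := by
        rw [hD]; exact colNorm_sum_le _ _
    _ ≤ ∑ j, |w j| * t := by
        refine Finset.sum_le_sum fun j _ => ?_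
        rw [colNorm_smul]
        exact mul_le_mul_of_nonneg_left (ht j) (abs_nonneg _)
    _ = t * ∑ j, |w j| := by rw [← Finset.sum_mul, mul_comm]
    _ ≤ t * Real.sqrt n * colNorm w := by
        rw [mul_assoc]
        exact mul_le_mul_of_nonneg_left habs ht0

lemma pow_card_le_det_of_le_quadForm {r : ℕ} {S : Matrix (Fin r) (Fin r) ℝ} (hS : S.IsHermitian)
    {c : ℝ} (hc : 0 ≤ c) (h : ∀ v, c * colNorm v ^ 2 ≤ v ⬝ᵥ S *ᵥ v) : c ^ r ≤ S.det := by
  have hev : ∀ i, c ≤ hS.eigenvalues i := fun i => by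
    have hi := h (hS.eigenvectorBasis i)
    have hn : colNorm (hS.eigenvectorBasis i : Fin r → ℝ) = 1 := by
      rw [colNorm_eq_norm]
      exact hS.eigenvectorBasis.orthonormal.1 i
    rw [hn] at hi
    simpa [hS.eigenvalues_eq i] using hi
  rw [hS.det_eq_prod_eigenvalues]
  calc c ^ r = ∏ _i : Fin r, c := by simp
    _ ≤ _ := Finset.prod_le_prod (fun _ _ => hc) fun i _ => hev i

lemma le_quadForm_of_le_eigenvalues {r : ℕ} {S : Matrix (Fin r) (Fin r) ℝ} (hS : S.IsHermitian)
    {c : ℝ} (h : ∀ i, c ≤ hS.eigenvalues i) (v : Fin r → ℝ) :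
    c * colNorm v ^ 2 ≤ v ⬝ᵥ S *ᵥ v := by
  open scoped MatrixOrder in
  have hle : algebraMap ℝ (Matrix (Fin r) (Fin r) ℝ) c ≤ S := by
    refine (algebraMap_le_iff_le_spectrum (a := S) hS).2 fun x hx => ?_
    rw [hS.spectrum_real_eq_range_eigenvalues] at hx
    obtain ⟨i, rfl⟩ := hx
    exact h i
  have hpsd : (S - algebraMap ℝ (Matrix (Fin r) (Fin r) ℝ) c).PosSemidef := hle
  have := hpsd.dotProduct_mulVec_nonneg v
  rw [sub_mulVec, dotProduct_sub, Algebra.algebraMap_eq_smul_one, smul_mulVec, one_mulVec,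
    dotProduct_smul, star_trivial, ← colNorm_sq, smul_eq_mul] at this
  linarith

lemma det_le_eigenvalue_mul_exp {r : ℕ} {S : Matrix (Fin r) (Fin r) ℝ} (hS : S.PosSemidef)
    (htr : S.trace ≤ r) (i : Fin r) :
    S.det ≤ hS.isHermitian.eigenvalues i * Real.exp (1 - hS.isHermitian.eigenvalues i) := by
  set l := hS.isHermitian.eigenvalues with hl
  have hdet : S.det = l i * ∏ j ∈ Finset.univ.erase i, l j := by
    rw [Finset.mul_prod_erase _ _ (Finset.mem_univ i)]
    exact hS.isHermitian.det_eq_prod_eigenvalues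
  have hsum : l i + ∑ j ∈ Finset.univ.erase i, l j ≤ r := by
    rw [Finset.add_sum_erase _ _ (Finset.mem_univ i)]
    exact hS.isHermitian.trace_eq_sum_eigenvalues.symm.trans_le htr
  have hr : 1 ≤ r := i.pos
  rw [hdet]
  refine mul_le_mul_of_nonneg_left ?_ (hS.eigenvalues_nonneg i)
  calc ∏ j ∈ Finset.univ.erase i, l j ≤ ∏ j ∈ Finset.univ.erase i, Real.exp (l j - 1) :=
        Finset.prod_le_prod (fun j _ => hS.eigenvalues_nonneg j) fun j _ => by
          linarith [Real.add_one_le_exp (l j - 1)]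
    _ = Real.exp (∑ j ∈ Finset.univ.erase i, (l j - 1)) := (Real.exp_sum _ _).symm
    _ ≤ Real.exp (1 - l i) := by
        refine Real.exp_le_exp.2 ?_
        simp only [Finset.sum_sub_distrib, Finset.sum_const, nsmul_eq_mul, mul_one,
          Finset.card_erase_of_mem (Finset.mem_univ i), Finset.card_univ, Fintype.card_fin]
        push_cast [hr]
        linarith

lemma le_of_le_mul_exp_one_sub {x : ℝ} (hx : 0 ≤ x) (h : 3 / 5 ≤ x * Real.exp (1 - x)) :
    289 / 1024 ≤ x := by
  by_contra! hlt
  have h1 : Real.exp (1 - x) * (1 + x) ≤ Real.exp 1 := by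
    calc Real.exp (1 - x) * (1 + x) ≤ Real.exp (1 - x) * Real.exp x := by
          gcongr
          linarith [Real.add_one_le_exp x]
      _ = Real.exp 1 := by rw [← Real.exp_add]; ring_nf
  have he := Real.exp_one_lt_d9
  have h2 : 3 / 5 * (1 + x) ≤ x * Real.exp 1 := by nlinarith
  nlinarith

/-- If `E` is a small perturbation of the identity whose columns satisfy the ellipsoid constraints
of `C`, and `det C` is close to one, then `C` is bounded below by `1/4`. -/
lemma quarter_le_quadForm {r : ℕ} (hr : 2 ≤ r) {C D : Matrix (Fin r) (Fin r) ℝ} {t : ℝ}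
    (ht : t = 1 / (8 * r * Real.sqrt r)) (hC : C.PosSemidef)
    (hD : ∀ j, colNorm (fun i => D i j) ≤ t)
    (hfeas : ∀ j, diag ((1 + D)ᵀ * C * (1 + D)) j ≤ 1) (hdet : (1 - t) ^ (2 * r) ≤ C.det)
    (v : Fin r → ℝ) : 1 / 4 * colNorm v ^ 2 ≤ v ⬝ᵥ C *ᵥ v := by
  have hr' : (2 : ℝ) ≤ r := by exact_mod_cast hr
  have hs : (7 / 5 : ℝ) ≤ Real.sqrt r := Real.le_sqrt_of_sq_le (by norm_num; linarith)
  have hspos : 0 < Real.sqrt r := by linarith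
  have htr : t * Real.sqrt r = 1 / (8 * r) := by
    rw [ht]; field_simp
  have hsmall : 1 / (8 * (r : ℝ)) ≤ 1 / 16 := by
    rw [div_le_div_iff₀ (by positivity) (by positivity)]; linarith
  have hDw : ∀ w, colNorm (D *ᵥ w) ≤ 1 / (8 * r) * colNorm w := fun w => by
    rw [← htr]; exact colNorm_mulVec_le D hD w
  set E := 1 + D with hE
  have hEw : ∀ w, E *ᵥ w = w + D *ᵥ w := fun w => by rw [hE, add_mulVec, one_mulVec]
  have hupper : ∀ w, colNorm (E *ᵥ w) ≤ 17 / 16 * colNorm w := fun w => by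
    rw [hEw]
    nlinarith [colNorm_add_le w (D *ᵥ w), hDw w, colNorm_nonneg w]
  have hlower : ∀ w, (1 - 1 / (8 * r)) * colNorm w ≤ colNorm (E *ᵥ w) := fun w => by
    have h1 := colNorm_add_le (E *ᵥ w) ((-1 : ℝ) • D *ᵥ w)
    have h2 : E *ᵥ w + (-1 : ℝ) • D *ᵥ w = w := by rw [hEw]; simp
    rw [h2, colNorm_smul] at h1
    norm_num at h1
    have := hDw w
    norm_num at this ⊢
    linarith
  have hEquad : ∀ (M : Matrix (Fin r) (Fin r) ℝ) (w : Fin r → ℝ),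
      w ⬝ᵥ (Eᵀ * M * E) *ᵥ w = (E *ᵥ w) ⬝ᵥ M *ᵥ (E *ᵥ w) := fun M w => by
    rw [← mulVec_mulVec, ← mulVec_mulVec, dotProduct_mulVec, vecMul_transpose]
  have hdetE : 3 / 4 ≤ E.det ^ 2 := by
    have hherm : (Eᵀ * 1 * E).IsHermitian := by
      simpa [conjTranspose_eq_transpose_of_trivial] using isHermitian_conjTranspose_mul_self E
    have h1 := pow_card_le_det_of_le_quadForm hherm (sq_nonneg (1 - 1 / (8 * (r : ℝ))))
      fun w => by
        rw [hEquad, one_mulVec, ← colNorm_sq, ← mul_pow]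
        exact pow_le_pow_left₀ (mul_nonneg (by linarith) (colNorm_nonneg w)) (hlower w) 2
    rw [mul_one, det_mul, det_transpose, ← sq, ← pow_mul] at h1
    have h2 := one_add_mul_le_pow (a := -(1 / (8 * (r : ℝ)))) (by linarith) (2 * r)
    have h3 : 1 + ((2 * r : ℕ) : ℝ) * -(1 / (8 * (r : ℝ))) = 3 / 4 := by
      push_cast; field_simp; norm_num
    rw [h3, ← sub_eq_add_neg] at h2
    exact h2.trans h1
  have hdetC : 4 / 5 ≤ C.det := by
    have ht0 : 2 * (r : ℝ) * t ≤ 1 / 5 := by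
      rw [ht, mul_one_div, div_le_div_iff₀ (by positivity) (by norm_num)]
      nlinarith
    have ht1 : t ≤ 1 := by
      have : 0 ≤ t := by rw [ht]; positivity
      nlinarith
    have h2 := one_add_mul_le_pow (a := -t) (by linarith) (2 * r)
    push_cast at h2
    rw [← sub_eq_add_neg] at h2
    linarith
  have hS : (Eᵀ * C * E).PosSemidef := by
    simpa [conjTranspose_eq_transpose_of_trivial] using hC.conjTranspose_mul_mul_same E
  have htrace : (Eᵀ * C * E).trace ≤ r := by
    simpa [trace] using Finset.sum_le_sum fun j (_ : j ∈ Finset.univ) => hfeas j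
  have hdetS : 3 / 5 ≤ (Eᵀ * C * E).det := by
    rw [det_mul, det_mul, det_transpose]
    nlinarith
  have hev : ∀ i, 289 / 1024 ≤ hS.isHermitian.eigenvalues i := fun i =>
    le_of_le_mul_exp_one_sub (hS.eigenvalues_nonneg i)
      (hdetS.trans (det_le_eigenvalue_mul_exp hS htrace i))
  have hunit : IsUnit E.det := by
    refine isUnit_iff_ne_zero.2 fun h0 => ?_
    rw [h0] at hdetE
    norm_num at hdetE
  obtain ⟨w, rfl⟩ : ∃ w, E *ᵥ w = v := ⟨E⁻¹ *ᵥ v, by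
    rw [mulVec_mulVec, mul_nonsing_inv _ hunit, one_mulVec]⟩
  have h1 := le_quadForm_of_le_eigenvalues hS.isHermitian hev w
  rw [hEquad] at h1
  have h2 := pow_le_pow_left₀ (colNorm_nonneg _) (hupper w) 2
  rw [mul_pow] at h2
  linarith

lemma colNorm_le_one_of_sum_le_one {m : ℕ} {h : Fin m → ℝ} (h0 : ∀ i, 0 ≤ h i)
    (h1 : ∑ i, h i ≤ 1) : colNorm h ≤ 1 := by
  rw [colNorm, Real.sqrt_le_one]
  calc ∑ i, h i ^ 2 ≤ (∑ i, h i) ^ 2 := Finset.sum_sq_le_sq_sum_of_nonneg fun i _ => h0 i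
    _ ≤ 1 := pow_le_one₀ (Finset.sum_nonneg fun i _ => h0 i) h1

/-- Scaling the noiseless solution `(W Wᵀ)⁻¹` by `(1 - t)²` keeps it feasible under noise. -/
lemma sdpFeasible_smul {r n : ℕ} {V : Matrix (Fin r) (Fin r) ℝ} {Mt : Matrix (Fin r) (Fin n) ℝ}
    {t : ℝ} (ht : t ≤ 1) (h : ∀ j, colNorm (V *ᵥ fun i => Mt i j) ≤ 1 + t) :
    SDPFeasible Mt ((1 - t) ^ 2 • (Vᵀ * V)) := by
  refine ⟨?_, fun j => ?_⟩
  · have : (Vᵀ * V).PosSemidef := by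
      simpa [conjTranspose_eq_transpose_of_trivial] using posSemidef_conjTranspose_mul_self V
    exact this.smul (sq_nonneg _)
  · rw [smul_mulVec, dotProduct_smul, ← mulVec_mulVec, dotProduct_mulVec, vecMul_transpose,
      ← colNorm_sq, smul_eq_mul, ← mul_pow]
    refine pow_le_one₀ (mul_nonneg (by linarith) (colNorm_nonneg _)) ?_
    linarith [mul_le_mul_of_nonneg_left (h j) (sub_nonneg.2 ht), sq_nonneg t,
      show (1 - t) * (1 + t) = 1 - t ^ 2 by ring]

/-- Improved bound: if `r ≥ 2` and `ε ≤ σ_min(W)/(8 r √r)`, then any optimal solution `A*`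
of the minimum-volume-ellipsoid SDP satisfies `λ_min(Wᵀ A* W) ≥ 1/4`. -/
theorem lamMin_lower_bound_improved (r n : ℕ) (W : Matrix (Fin r) (Fin r) ℝ)
    (H : Matrix (Fin r) (Fin n) ℝ) (N Mt : Matrix (Fin r) (Fin n) ℝ) (ε : ℝ)
    (A : Matrix (Fin r) (Fin r) ℝ)
    (hr : 2 ≤ r) (hsep : NearSepSquare r n W H N Mt ε)
    (hε : ε ≤ sigmaMin W / (8 * r * Real.sqrt r)) (hA : SDPOptimal Mt A) :
    (1 : ℝ) / 4 ≤ lamMin (Wᵀ * A * W) := by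
  obtain ⟨hW, hMt, hH0, hH1, ⟨hrn, hHI⟩, hε0, hN⟩ := hsep
  obtain ⟨⟨hApsd, hAfeas⟩, hAopt⟩ := hA
  obtain ⟨t, ht⟩ : ∃ t : ℝ, t = 1 / (8 * r * Real.sqrt r) := ⟨_, rfl⟩
  have hr' : (2 : ℝ) ≤ r := by exact_mod_cast hr
  have hs : 1 ≤ Real.sqrt r := Real.le_sqrt_of_sq_le (by norm_num; linarith)
  have ht0 : 0 < t := by rw [ht]; positivity
  have ht1 : t ≤ 1 := by
    rw [ht, div_le_one (by positivity)]
    nlinarith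
  rw [div_eq_mul_one_div, ← ht] at hε
  have hWV : W * W⁻¹ = 1 := mul_nonsing_inv _ hW
  have hVW : W⁻¹ * W = 1 := nonsing_inv_mul _ hW
  have hnoise : ∀ j, colNorm (W⁻¹ *ᵥ fun i => N i j) ≤ t := fun j => by
    have h1 := sigmaMin_mul_colNorm_le W (W⁻¹ *ᵥ fun i => N i j)
    rw [mulVec_mulVec, hWV, one_mulVec] at h1
    have h2 := hN j
    rcases lt_or_ge 0 (sigmaMin W) with hpos | hneg
    · exact le_of_mul_le_mul_left (h1.trans (h2.trans hε)) hpos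
    · have h3 : (fun i => N i j) = 0 :=
        colNorm_eq_zero (le_antisymm (by nlinarith) (colNorm_nonneg _))
      rw [h3, mulVec_zero]
      simpa [colNorm] using ht0.le
  have hcol : ∀ j, (fun i => Mt i j) = W *ᵥ (fun i => H i j) + fun i => N i j := fun j => by
    ext i
    simp [hMt, mul_apply, mulVec, dotProduct]
  have hVcol : ∀ j, W⁻¹ *ᵥ (fun i => Mt i j) = (fun i => H i j) + W⁻¹ *ᵥ fun i => N i j :=
    fun j => by rw [hcol, mulVec_add, mulVec_mulVec, hVW, one_mulVec]
  have hdet : (1 - t) ^ (2 * r) ≤ (Wᵀ * A * W).det := by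
    have h1 := hAopt _ (sdpFeasible_smul (V := W⁻¹) ht1 fun j => by
      rw [hVcol]
      linarith [colNorm_add_le (fun i => H i j) (W⁻¹ *ᵥ fun i => N i j), hnoise j,
        colNorm_le_one_of_sum_le_one (fun i => hH0 i j) (hH1 j)])
    have h2 : W⁻¹.det * W.det = 1 := by rw [← det_mul, hVW, det_one]
    rw [det_smul, Fintype.card_fin, det_mul, det_transpose, ← pow_mul] at h1
    rw [det_mul, det_mul, det_transpose]
    calc (1 - t) ^ (2 * r) = (1 - t) ^ (2 * r) * (W⁻¹.det * W.det) ^ 2 := by rw [h2]; ring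
      _ = (1 - t) ^ (2 * r) * (W⁻¹.det * W⁻¹.det) * W.det ^ 2 := by ring
      _ ≤ A.det * W.det ^ 2 := mul_le_mul_of_nonneg_right h1 (sq_nonneg _)
      _ = W.det * A.det * W.det := by ring
  have hC : (Wᵀ * A * W).PosSemidef := by
    simpa [conjTranspose_eq_transpose_of_trivial] using hApsd.conjTranspose_mul_mul_same W
  set D : Matrix (Fin r) (Fin r) ℝ := of fun i j =>
    (W⁻¹ *ᵥ fun k => N k (Fin.castLE hrn j)) i with hD
  have hWE : W * (1 + D) = of fun i j => Mt i (Fin.castLE hrn j) := by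
    have hE : 1 + D = of fun i j => (W⁻¹ *ᵥ fun k => Mt k (Fin.castLE hrn j)) i := by
      ext i j
      rw [of_apply, hVcol]
      simp [hD, hHI, one_apply]
    have hE' : 1 + D = W⁻¹ * of fun i j => Mt i (Fin.castLE hrn j) := by
      rw [hE]; rfl
    rw [hE', ← Matrix.mul_assoc, hWV, Matrix.one_mul]
  have hfeas : ∀ j, diag ((1 + D)ᵀ * (Wᵀ * A * W) * (1 + D)) j ≤ 1 := fun j => by
    have h1 : (1 + D)ᵀ * (Wᵀ * A * W) * (1 + D) = (W * (1 + D))ᵀ * (A * (W * (1 + D))) := by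
      simp only [transpose_mul, Matrix.mul_assoc]
    rw [h1, hWE]
    exact hAfeas (Fin.castLE hrn j)
  refine le_csInf ⟨_, Pi.single ⟨0, by omega⟩ 1, ?_, rfl⟩ ?_
  · simp [colNorm_eq_norm]
  · rintro c ⟨v, hv, rfl⟩
    have := quarter_le_quadForm hr ht hC (fun j => hnoise _) hfeas hdet v
    rwa [hv, one_pow, mul_one] at this
end

section
/- For every integer r ≥ 2, one has ( (r/(r−1)) · (1 + 1/(4 r √r))² )^{r−1} ≤ 3. -/
theorem Real.le_exp_half_sub_inv {x : ℝ} (hx : 1 ≤ x) : x ≤ Real.exp ((x - x⁻¹) / 2) := by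
  have h0 : 0 < x := by linarith
  rw [← Real.log_le_iff_le_exp h0, ← Real.sinh_log h0]
  exact Real.self_le_sinh_iff.2 (Real.log_nonneg hx)

theorem Real.exp_fiftyNine_div_fiftyFour_le_three : Real.exp (59 / 54) ≤ 3 := by
  have h1 := Real.exp_one_lt_d9
  have h2 : Real.exp (5 / 54) ≤ 54 / 49 := by
    have h := Real.one_sub_le_exp_neg (5 / 54)
    rw [Real.exp_neg] at h
    have h3 := inv_anti₀ (by norm_num) h
    rw [inv_inv] at h3
    norm_num at h3 ⊢
    exact h3
  have h3 : (59 / 54 : ℝ) = 1 + 5 / 54 := by norm_num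
  rw [h3, Real.exp_add]
  nlinarith [Real.exp_pos 1, Real.exp_pos (5 / 54)]

/-- For every integer `r ≥ 2`, `((r/(r−1)) (1 + 1/(4 r √r))²)^{r−1} ≤ 3`. -/
theorem det_upper_constant_bound (r : ℕ) (hr : 2 ≤ r) :
    (((r : ℝ) / ((r : ℝ) - 1)) * (1 + 1 / (4 * (r : ℝ) * Real.sqrt r)) ^ 2) ^ (r - 1)
      ≤ 3 := by
  have hr' : (2 : ℝ) ≤ r := by exact_mod_cast hr
  have hcast : ((r - 1 : ℕ) : ℝ) = (r : ℝ) - 1 := by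
    rw [Nat.cast_sub (by lia), Nat.cast_one]
  set q := Real.sqrt r with hq
  have hq0 : 0 < q := Real.sqrt_pos.2 (by linarith)
  have hqq : (r : ℝ) = q ^ 2 := (Real.sq_sqrt (by linarith)).symm
  set a := (r : ℝ) / ((r : ℝ) - 1) with ha
  set e := 1 / (4 * (r : ℝ) * q) with he
  have ha1 : 1 ≤ a := by
    rw [ha, le_div_iff₀ (by linarith)]
    linarith
  have he0 : 0 ≤ e := by positivity
  have hbase : a * (1 + e) ^ 2 ≤ Real.exp ((a - a⁻¹) / 2 + 2 * e) := by
    have h1 : 1 + e ≤ Real.exp e := by linarith [Real.add_one_le_exp e]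
    have h2 : Real.exp (2 * e) = Real.exp e ^ 2 := by
      rw [← Real.exp_nat_mul, Nat.cast_ofNat]
    rw [Real.exp_add, h2]
    have := Real.le_exp_half_sub_inv ha1
    gcongr
  have hexp : ((r - 1 : ℕ) : ℝ) * ((a - a⁻¹) / 2 + 2 * e) ≤ 59 / 54 := by
    have hne : q ^ 2 - 1 ≠ 0 := by
      rw [← hqq]
      linarith
    have hdiff : 59 / 54 - (q ^ 2 - 1) * ((a - a⁻¹) / 2 + 2 * e)
        = (q - 3) ^ 2 * (5 * q + 3) / (54 * q ^ 3) := by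
      rw [ha, he, hqq]
      field_simp
      ring
    have : 0 ≤ (q - 3) ^ 2 * (5 * q + 3) / (54 * q ^ 3) := by positivity
    rw [hcast, hqq]
    linarith
  calc (a * (1 + e) ^ 2) ^ (r - 1)
      ≤ Real.exp ((a - a⁻¹) / 2 + 2 * e) ^ (r - 1) :=
        pow_le_pow_left₀ (by positivity) hbase _
    _ = Real.exp (((r - 1 : ℕ) : ℝ) * ((a - a⁻¹) / 2 + 2 * e)) := (Real.exp_nat_mul _ _).symm
    _ ≤ Real.exp (59 / 54) := Real.exp_le_exp.2 hexp
    _ ≤ 3 := Real.exp_fiftyNine_div_fiftyFour_le_three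
end

section
/- Let r ≥ 2 be an integer and let λ ≥ 0 be a real number such that (r−1) · (1 + 1/(8r))^{−2r/(r−1)} ≤ λ^{1/(r−1)} · (r + 1 − λ). Then λ ≤ 4. -/
/-- If `r ≥ 2` is an integer and `λ ≥ 0` satisfies
`(r−1) (1 + 1/(8r))^{−2r/(r−1)} ≤ λ^{1/(r−1)} (r + 1 − λ)`, then `λ ≤ 4`. -/
theorem lambda_le_four (r : ℕ) (hr : 2 ≤ r) (lam : ℝ) (hlam : 0 ≤ lam)
    (h : ((r : ℝ) - 1) * (1 + 1 / (8 * (r : ℝ))) ^ (-(2 * (r : ℝ)) / ((r : ℝ) - 1)) ≤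
      lam ^ ((1 : ℝ) / ((r : ℝ) - 1)) * ((r : ℝ) + 1 - lam)) :
    lam ≤ 4 := by
  by_contra! h4
  have hr' : (2 : ℝ) ≤ r := by exact_mod_cast hr
  have hr0 : (0 : ℝ) < r := by linarith
  obtain ⟨n, hn⟩ : ∃ n : ℝ, n = (r : ℝ) - 1 := ⟨_, rfl⟩
  have hn0 : 0 < n := by linarith
  rw [← hn] at h
  have hlower : Real.exp (-(1 / 4) / n) ≤
      (1 + 1 / (8 * (r : ℝ))) ^ (-(2 * (r : ℝ)) / n) := by
    have hexp : -(1 / 4) / n = 1 / (8 * (r : ℝ)) * (-(2 * (r : ℝ)) / n) := by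
      field_simp
      norm_num
    rw [hexp, Real.exp_mul]
    refine Real.rpow_le_rpow_of_nonpos (by positivity) ?_ ?_
    · linarith [Real.add_one_le_exp (1 / (8 * (r : ℝ)))]
    · exact div_nonpos_of_nonpos_of_nonneg (by linarith) hn0.le
  have hlam_exp : lam < Real.exp (lam - 9 / 4) := by
    have hquad := Real.quadratic_le_exp_of_nonneg (x := lam - 9 / 4) (by linarith)
    nlinarith
  have hpow : lam ^ ((1 : ℝ) / n) < Real.exp ((lam - 9 / 4) / n) := by
    rw [← mul_one_div (lam - 9 / 4), Real.exp_mul]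
    exact Real.rpow_lt_rpow hlam hlam_exp (by positivity)
  have hlin : (r : ℝ) + 1 - lam ≤ n * Real.exp ((2 - lam) / n) := by
    calc (r : ℝ) + 1 - lam = n * ((2 - lam) / n + 1) := by field_simp; linarith
      _ ≤ _ := mul_le_mul_of_nonneg_left (Real.add_one_le_exp _) hn0.le
  refine lt_irrefl (n * Real.exp (-(1 / 4) / n)) ?_
  calc n * Real.exp (-(1 / 4) / n)
      ≤ n * (1 + 1 / (8 * (r : ℝ))) ^ (-(2 * (r : ℝ)) / n) := by gcongr
    _ ≤ lam ^ ((1 : ℝ) / n) * ((r : ℝ) + 1 - lam) := h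
    _ ≤ lam ^ ((1 : ℝ) / n) * (n * Real.exp ((2 - lam) / n)) := by gcongr
    _ < Real.exp ((lam - 9 / 4) / n) * (n * Real.exp ((2 - lam) / n)) := by gcongr
    _ = n * Real.exp (-(1 / 4) / n) := by
      rw [mul_left_comm, ← Real.exp_add]
      congr 2
      ring
end

section
/- For every real number r ≥ 13, one has ((r−1)/(r−3))^{r} > 5 · (1 + 1/(3r))^{r}. -/
/-- For every real `r ≥ 13`, `((r−1)/(r−3))^r > 5 (1 + 1/(3r))^r`. -/
theorem ratio_power_inequality (r : ℝ) (hr : 13 ≤ r) :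
    5 * (1 + 1 / (3 * r)) ^ r < ((r - 1) / (r - 3)) ^ r := by
  have hr0 : 0 < r := by linarith
  have hr1 : 0 < r - 1 := by linarith
  have hr3 : 0 < r - 3 := by linarith
  have upper : (1 + 1 / (3 * r)) ^ r ≤ Real.exp (1 / 3) := by
    calc (1 + 1 / (3 * r)) ^ r ≤ Real.exp (1 / (3 * r)) ^ r := by
          gcongr
          linarith [Real.add_one_le_exp (1 / (3 * r))]
      _ = Real.exp (1 / 3) := by
          rw [← Real.exp_mul]
          congr 1
          field_simp
  have lower : Real.exp 2 ≤ ((r - 1) / (r - 3)) ^ r := by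
    have hpos : 0 < (r - 1) / (r - 3) := div_pos hr1 hr3
    rw [Real.rpow_def_of_pos hpos, Real.exp_le_exp]
    have hlog : 2 / (r - 1) ≤ Real.log ((r - 1) / (r - 3)) := by
      convert Real.one_sub_inv_le_log_of_pos hpos using 1
      field_simp
      ring
    calc (2 : ℝ) ≤ 2 / (r - 1) * r := by
          rw [div_mul_eq_mul_div, le_div_iff₀ hr1]
          linarith
      _ ≤ Real.log ((r - 1) / (r - 3)) * r := by gcongr
  have five_lt : 5 < Real.exp (5 / 3) := by
    refine lt_of_pow_lt_pow_left₀ 3 (Real.exp_pos _).le ?_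
    calc (5 : ℝ) ^ 3 < 2.7 ^ 5 := by norm_num
      _ ≤ Real.exp 1 ^ 5 := by
          gcongr
          linarith [Real.exp_one_gt_d9]
      _ = Real.exp (5 / 3) ^ 3 := by
          rw [← Real.exp_nat_mul, ← Real.exp_nat_mul]
          norm_num
  calc 5 * (1 + 1 / (3 * r)) ^ r ≤ 5 * Real.exp (1 / 3) := by gcongr
    _ < Real.exp (5 / 3) * Real.exp (1 / 3) := by gcongr
    _ = Real.exp 2 := by
        rw [← Real.exp_add]
        norm_num
    _ ≤ ((r - 1) / (r - 3)) ^ r := lower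
end
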